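/- arXiv:1306.1209 — 15 statements merged into one kernel-verified Lean document; each statement's English description precedes it below -/
import Mathlib

section
/- Let Y be a nonempty partially ordered set. Suppose that for every partially ordered set X and every subset A of X (with the induced order), every isotone map f : A → Y has an isotone extension g : X → Y. Then Y is a complete lattice, i.e., every subset of Y has a supremum and an infimum in Y. -/
universe u

/-- If a nonempty poset `Y` has the property that every isotone map from a
subset of any poset `X` into `Y` extends to an isotone map on all of `X`, then `Y` is a
complete lattice (every subset of `Y` has a supremum and an infimum in `Y`). -/
theorem complete_lattice_of_extension_property {Y : Type u} [PartialOrder Y] [Nonempty Y]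
    (h : ∀ (X : Type u) [PartialOrder X] (A : Set X) (f : A → Y), Monotone f →
      ∃ g : X → Y, Monotone g ∧ ∀ a : A, g (a : X) = f a) :
    ∀ S : Set Y, (∃ y : Y, IsLUB S y) ∧ (∃ y : Y, IsGLB S y) := by
  have hA : ∀ a : Set.range (LowerSet.Iic : Y → LowerSet Y), ∃ y, LowerSet.Iic y = a.1 :=
    fun a => a.2
  choose f hf using hA
  have hmono : Monotone f := fun a b hab => by
    rw [← Subtype.coe_le_coe, ← hf a, ← hf b] at hab
    exact LowerSet.Iic_le.1 hab
  obtain ⟨g, hg, hgf⟩ := h (LowerSet Y) _ f hmono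
  have hgIic : ∀ y, g (LowerSet.Iic y) = y := fun y =>
    (hgf ⟨LowerSet.Iic y, y, rfl⟩).trans (LowerSet.Iic_injective (hf _))
  have hsup : ∀ S : Set Y, IsLUB S (g (lowerClosure S)) := fun S => by
    refine ⟨fun s hs => ?_, fun u hu => ?_⟩
    · rw [← hgIic s]
      exact hg (LowerSet.Iic_le.2 (subset_lowerClosure hs))
    · rw [← hgIic u]
      exact hg (lowerClosure_min hu (LowerSet.Iic u).lower)
  exact fun S => ⟨⟨_, hsup S⟩, ⟨_, isLUB_lowerBounds.1 (hsup (lowerBounds S))⟩⟩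
end

section
/- Let X be a complete lattice and let A be a subset of X equipped with the induced order. If the identity map id : A → A has an isotone extension g : X → A (i.e., g is isotone and g(a) = a for all a ∈ A), then A is a complete lattice with respect to the induced order: every nonempty subset of A has a supremum and an infimum in A. -/
/-- If `X` is a complete lattice, `A ⊆ X` carries the induced order, and the
identity map of `A` has an isotone extension `g : X → A`, then `A` is a complete lattice
for the induced order: every nonempty subset of `A` has a supremum and an infimum in `A`. -/
theorem retract_is_complete_lattice {X : Type*} [CompleteLattice X] (A : Set X)
    (g : X → A) (hg : Monotone g) (hid : ∀ a : A, g (a : X) = a) :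
    ∀ S : Set A, S.Nonempty → (∃ m : A, IsLUB S m) ∧ (∃ m : A, IsGLB S m) := by
  intro S _
  refine ⟨⟨g (sSup (Subtype.val '' S)), fun a ha => ?_, fun b hb => ?_⟩,
    ⟨g (sInf (Subtype.val '' S)), fun a ha => ?_, fun b hb => ?_⟩⟩
  · exact (hid a).ge.trans (hg (le_sSup (Set.mem_image_of_mem _ ha)))
  · refine (hg (sSup_le ?_)).trans (hid b).le
    rintro _ ⟨a, ha, rfl⟩
    exact hb ha
  · exact (hg (sInf_le (Set.mem_image_of_mem _ ha))).trans (hid a).le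
  · refine (hid b).ge.trans (hg (le_sInf ?_))
    rintro _ ⟨a, ha, rfl⟩
    exact hb ha
end

section
/- Let Y be a complete lattice, X a partially ordered set, A a subset of X with the induced order, and f : A → Y an isotone map. Let F be the set of all isotone extensions g : X → Y of f, partially ordered pointwise (g ≤ Ψ iff g(x) ≤ Ψ(x) for all x ∈ X). Then F is a complete lattice; its least element is the map f_*(x) = sup_Y { f(t) : t ∈ A, t ≤ x } and its greatest element is the map f^*(x) = inf_Y { f(t) : t ∈ A, x ≤ t }. -/
/-- For a complete lattice `Y`, a poset `X`, `A ⊆ X` with the induced order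
and an isotone `f : A → Y`, the set `F` of all isotone extensions of `f`, ordered
pointwise, is a complete lattice, whose least element is
`f_*(x) = sup { f t : t ∈ A, t ≤ x }` and whose greatest element is
`f^*(x) = inf { f t : t ∈ A, x ≤ t }`. -/
theorem extensions_form_complete_lattice {X Y : Type*} [PartialOrder X] [CompleteLattice Y]
    (A : Set X) (f : A → Y) (hf : Monotone f)
    (F : Set (X → Y)) (hF : F = {g : X → Y | Monotone g ∧ ∀ a : A, g (a : X) = f a})
    (fLower fUpper : X → Y)
    (hlo : ∀ x : X, fLower x = sSup {y : Y | ∃ t : A, (t : X) ≤ x ∧ f t = y})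
    (hup : ∀ x : X, fUpper x = sInf {y : Y | ∃ t : A, x ≤ (t : X) ∧ f t = y}) :
    (∀ S : Set F, (∃ m : F, IsLUB S m) ∧ (∃ m : F, IsGLB S m)) ∧
      IsLeast F fLower ∧ IsGreatest F fUpper := by
  subst hF
  have lower_mem : Monotone fLower ∧ ∀ a : A, fLower (a : X) = f a := by
    refine ⟨fun x y hxy => ?_, fun a => ?_⟩
    · rw [hlo, hlo]
      exact sSup_le_sSup fun _ ⟨t, ht, e⟩ => ⟨t, ht.trans hxy, e⟩
    · rw [hlo]
      refine le_antisymm (sSup_le ?_) (le_sSup ⟨a, le_rfl, rfl⟩)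
      rintro _ ⟨t, ht, rfl⟩
      exact hf ht
  have upper_mem : Monotone fUpper ∧ ∀ a : A, fUpper (a : X) = f a := by
    refine ⟨fun x y hxy => ?_, fun a => ?_⟩
    · rw [hup, hup]
      exact sInf_le_sInf fun _ ⟨t, ht, e⟩ => ⟨t, hxy.trans ht, e⟩
    · rw [hup]
      refine le_antisymm (sInf_le ⟨a, le_rfl, rfl⟩) (le_sInf ?_)
      rintro _ ⟨t, ht, rfl⟩
      exact hf ht
  have lower_le : ∀ g : X → Y, (Monotone g ∧ ∀ a : A, g (a : X) = f a) → fLower ≤ g := by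
    rintro g ⟨hg, hgf⟩ x
    rw [hlo]
    refine sSup_le ?_
    rintro _ ⟨t, ht, rfl⟩
    exact hgf t ▸ hg ht
  have le_upper : ∀ g : X → Y, (Monotone g ∧ ∀ a : A, g (a : X) = f a) → g ≤ fUpper := by
    rintro g ⟨hg, hgf⟩ x
    rw [hup]
    refine le_sInf ?_
    rintro _ ⟨t, ht, rfl⟩
    exact hgf t ▸ hg ht
  refine ⟨fun S => ⟨?_, ?_⟩, ⟨lower_mem, lower_le⟩, ⟨upper_mem, le_upper⟩⟩
  · refine ⟨⟨fun x => fLower x ⊔ ⨆ g ∈ S, g.1 x, fun x y hxy => ?_, fun a => ?_⟩, ?_, ?_⟩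
    · exact sup_le_sup (lower_mem.1 hxy) (iSup₂_mono fun g _ => g.2.1 hxy)
    · simp only [lower_mem.2 a]
      exact sup_eq_left.2 (iSup₂_le fun g _ => (g.2.2 a).le)
    · exact fun g hg x => le_sup_of_le_right (le_iSup₂ (f := fun (g : _) (_ : g ∈ S) => g.1 x) g hg)
    · exact fun h hh x => sup_le (lower_le h.1 h.2 x) (iSup₂_le fun g hg => hh hg x)
  · refine ⟨⟨fun x => fUpper x ⊓ ⨅ g ∈ S, g.1 x, fun x y hxy => ?_, fun a => ?_⟩, ?_, ?_⟩
    · exact inf_le_inf (upper_mem.1 hxy) (iInf₂_mono fun g _ => g.2.1 hxy)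
    · simp only [upper_mem.2 a]
      exact inf_eq_left.2 (le_iInf₂ fun g _ => (g.2.2 a).ge)
    · exact fun g hg x => inf_le_of_right_le (iInf₂_le (f := fun (g : _) (_ : g ∈ S) => g.1 x) g hg)
    · exact fun h hh x => le_inf (le_upper h.1 h.2 x) (le_iInf₂ fun g hg => hh hg x)
end

section
/- Let A be a complete lattice. Then for every partially ordered set Y, every partially ordered set X containing A as a subset whose induced order coincides with the order of A (equivalently, for every order embedding e : A → X), every isotone map f : A → Y has an isotone extension to X, i.e., there exists an isotone map Ψ : X → Y with Ψ(e(a)) = f(a) for all a ∈ A. -/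
/-- If `A` is a complete lattice, then for every poset `Y`, every poset `X`
containing `A` (via an order embedding `e : A ↪o X`) and every isotone `f : A → Y`,
there is an isotone `Ψ : X → Y` with `Ψ (e a) = f a` for all `a`. -/
theorem complete_lattice_domain_extension {A X Y : Type*} [CompleteLattice A]
    [PartialOrder X] [PartialOrder Y] (e : A ↪o X) (f : A → Y) (hf : Monotone f) :
    ∃ Ψ : X → Y, Monotone Ψ ∧ ∀ a : A, Ψ (e a) = f a := by
  refine ⟨fun x => f (sSup {a | e a ≤ x}), fun x y hxy => hf ?_, fun a => congrArg f ?_⟩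
  · exact sSup_le_sSup fun a ha => le_trans ha hxy
  · simp only [e.le_iff_le]
    exact csSup_Iic
end

section
/- Let A be a partially ordered set. Suppose that for every partially ordered set Y, every partially ordered set X containing A as a subset whose induced order coincides with the order of A (equivalently, for every order embedding e : A → X), and every isotone map f : A → Y, there exists an isotone map Ψ : X → Y with Ψ(e(a)) = f(a) for all a ∈ A. Then A is a complete lattice. -/
universe u

/-- If the identity of `A` extends to an isotone map on the lower sets of `A`, along the
principal ideal embedding, then every subset of `A` has a least upper bound. -/
theorem exists_isLUB_of_lowerSet_retraction {A : Type*} [PartialOrder A]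
    {Ψ : LowerSet A → A} (hΨ : Monotone Ψ) (hid : ∀ a, Ψ (LowerSet.Iic a) = a) (S : Set A) :
    ∃ m : A, IsLUB S m := by
  refine ⟨Ψ (lowerClosure S), fun s hs => ?_, fun b hb => ?_⟩
  · rw [← hid s]
    exact hΨ (LowerSet.Iic_le.2 (subset_lowerClosure hs))
  · rw [← hid b]
    exact hΨ (lowerClosure_le.2 fun s hs => hb hs)

/-- If a poset `A` has the property that for every poset `Y`, every poset
`X` containing `A` (via an order embedding `e : A ↪o X`) and every isotone `f : A → Y`
there is an isotone `Ψ : X → Y` with `Ψ (e a) = f a` for all `a`, then `A` is a complete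
lattice. -/
theorem complete_lattice_of_domain_extension {A : Type u} [PartialOrder A]
    (h : ∀ (X : Type u) [PartialOrder X] (Y : Type u) [PartialOrder Y]
      (e : A ↪o X) (f : A → Y), Monotone f →
        ∃ Ψ : X → Y, Monotone Ψ ∧ ∀ a : A, Ψ (e a) = f a) :
    ∀ S : Set A, (∃ m : A, IsLUB S m) ∧ (∃ m : A, IsGLB S m) := by
  obtain ⟨Ψ, hΨ, hid⟩ := h (LowerSet A) A
    (OrderEmbedding.ofMapLEIff LowerSet.Iic fun _ _ => by simp [LowerSet.Iic_le]) id monotone_id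
  have hlub := exists_isLUB_of_lowerSet_retraction hΨ hid
  exact fun S => ⟨hlub S, (hlub (lowerBounds S)).imp fun _ => isLUB_lowerBounds.1⟩
end

section
/- Let X be a cardinally indecomposable partially ordered set that is not a chain (i.e., X contains two incomparable elements). Then there exists a subset A of X (with the induced order) such that the identity map id : A → A has no isotone extension g : X → A. Concretely, if a, b ∈ X are incomparable, then the identity on A = {a, b} has no isotone extension from X to A. -/
/-- An isotone map into an antichain is constant along comparability chains. -/
theorem Monotone.eq_of_reflTransGen_of_antichain {X Y : Type*} [Preorder X] [Preorder Y]
    {g : X → Y} (hg : Monotone g) (hY : ∀ s t : Y, s ≤ t → s = t) {x y : X}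
    (h : Relation.ReflTransGen (fun u v : X => u ≤ v ∨ v ≤ u) x y) : g x = g y := by
  induction h with
  | refl => rfl
  | tail _ huv ih =>
    rcases huv with huv | huv
    · exact ih.trans (hY _ _ (hg huv))
    · exact ih.trans (hY _ _ (hg huv)).symm

/-- In a cardinally indecomposable poset `X`, if `a` and `b` are
incomparable then the identity map of `A = {a, b}` has no isotone extension `X → A`. -/
theorem no_extension_of_incomparable {X : Type*} [PartialOrder X]
    (hX : ∀ x y : X, Relation.ReflTransGen (fun u v : X => u ≤ v ∨ v ≤ u) x y)
    (a b : X) (hab : ¬ (a ≤ b ∨ b ≤ a)) :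
    ¬ ∃ g : X → ({a, b} : Set X), Monotone g ∧
        ∀ t : ({a, b} : Set X), g (t : X) = t := by
  rintro ⟨g, hg, hid⟩
  have hanti : ∀ s t : ({a, b} : Set X), s ≤ t → s = t := by
    rintro ⟨s, rfl | rfl⟩ ⟨t, rfl | rfl⟩ hst
    · rfl
    · exact absurd (Or.inl hst) hab
    · exact absurd (Or.inr hst) hab
    · rfl
  have hgab : g a = g b := hg.eq_of_reflTransGen_of_antichain hanti (hX a b)
  have ha : g a = ⟨a, Or.inl rfl⟩ := hid ⟨a, Or.inl rfl⟩
  have hb : g b = ⟨b, Or.inr rfl⟩ := hid ⟨b, Or.inr rfl⟩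
  rw [ha, hb] at hgab
  exact hab (Or.inl (Subtype.mk.inj hgab).le)
end

section
/- Let X be a chain (linearly ordered set), let x₁ ∈ X, and let A = { x ∈ X : x < x₁ } with the induced order. Suppose x₁ is not the least element of X, but no element of X immediately precedes x₁ (i.e., there is no x₀ < x₁ such that no element of X lies strictly between x₀ and x₁). Then the identity map id : A → A has no isotone extension g : X → A. -/
/-- Let `X` be a chain, `x₁ ∈ X` and `A = {x ∈ X : x < x₁}`. If `x₁` is not
the least element of `X` but no element of `X` immediately precedes `x₁`, then the
identity map of `A` has no isotone extension `X → A`. -/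
theorem no_extension_without_immediate_predecessor {X : Type*} [LinearOrder X] (x₁ : X)
    (h₁ : ¬ ∀ x : X, x₁ ≤ x)
    (h₂ : ¬ ∃ x₀ : X, x₀ < x₁ ∧ ∀ x : X, ¬ (x₀ < x ∧ x < x₁)) :
    ¬ ∃ g : X → ({x : X | x < x₁} : Set X), Monotone g ∧
        ∀ t : ({x : X | x < x₁} : Set X), g (t : X) = t := by
  rintro ⟨g, hg, hid⟩
  refine h₂ ⟨g x₁, (g x₁).2, fun x hx => ?_⟩
  have hle : g x ≤ g x₁ := hg hx.2.le
  rw [hid ⟨x, hx.2⟩] at hle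
  exact absurd hx.1 (not_lt_of_ge hle)
end

section
/- Let X be a chain (linearly ordered set), let x₁ ∈ X, and let A = { x ∈ X : x > x₁ } with the induced order. Suppose x₁ is not the greatest element of X, but no element of X immediately succeeds x₁ (i.e., there is no x₂ > x₁ such that no element of X lies strictly between x₁ and x₂). Then the identity map id : A → A has no isotone extension g : X → A. -/
/-- Let `X` be a chain, `x₁ ∈ X` and `A = {x ∈ X : x > x₁}`. If `x₁` is not
the greatest element of `X` but no element of `X` immediately succeeds `x₁`, then the
identity map of `A` has no isotone extension `X → A`. -/
theorem no_extension_without_immediate_successor {X : Type*} [LinearOrder X] (x₁ : X)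
    (h₁ : ¬ ∀ x : X, x ≤ x₁)
    (h₂ : ¬ ∃ x₂ : X, x₁ < x₂ ∧ ∀ x : X, ¬ (x₁ < x ∧ x < x₂)) :
    ¬ ∃ g : X → ({x : X | x₁ < x} : Set X), Monotone g ∧
        ∀ t : ({x : X | x₁ < x} : Set X), g (t : X) = t := by
  rintro ⟨g, hg, hid⟩
  refine h₂ ⟨g x₁, (g x₁).2, fun x ⟨hx₁, hx⟩ => hx.not_ge ?_⟩
  have h : ((g x₁ : {x : X | x₁ < x}) : X) ≤ g x := hg hx₁.le
  rwa [hid ⟨x, hx₁⟩] at h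
end

section
/- Let X be a linearly ordered set. Then X is order-isomorphic to a subset of the integers ℤ (with the usual order) if and only if the following holds: for every subset B of X and every b₁ ∈ B, if b₁ is not the least element of B then there exists b₀ ∈ B with b₀ < b₁ and no element of B strictly between b₀ and b₁, and if b₁ is not the greatest element of B then there exists b₂ ∈ B with b₁ < b₂ and no element of B strictly between b₁ and b₂. -/
/-- In a linear order with a strictly monotone map to `ℤ`, every element that is not greatest in a
set has an immediate successor in that set. -/
theorem StrictMono.exists_succ_mem {X : Type*} [LinearOrder X] {f : X → ℤ} (hf : StrictMono f)
    {B : Set X} {b₁ : X} (h : ¬ ∀ b ∈ B, b ≤ b₁) :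
    ∃ b₂ ∈ B, b₁ < b₂ ∧ ∀ b ∈ B, ¬ (b₁ < b ∧ b < b₂) := by
  push Not at h
  obtain ⟨c, hc, hlt⟩ := h
  obtain ⟨_, ⟨b₂, hb₂, hlt₂, rfl⟩, hmin⟩ :=
    Int.exists_least_of_bdd (P := fun z ↦ ∃ b ∈ B, b₁ < b ∧ f b = z)
      ⟨f b₁, by rintro _ ⟨b, -, hb, rfl⟩; exact (hf hb).le⟩ ⟨f c, c, hc, hlt, rfl⟩
  exact ⟨b₂, hb₂, hlt₂, fun b hb hbb ↦ (hf hbb.2).not_ge (hmin _ ⟨b, hb, hbb.1, rfl⟩)⟩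

/-- In a linear order with a strictly monotone map to `ℤ`, every element that is not least in a
set has an immediate predecessor in that set. -/
theorem StrictMono.exists_pred_mem {X : Type*} [LinearOrder X] {f : X → ℤ} (hf : StrictMono f)
    {B : Set X} {b₁ : X} (h : ¬ ∀ b ∈ B, b₁ ≤ b) :
    ∃ b₀ ∈ B, b₀ < b₁ ∧ ∀ b ∈ B, ¬ (b₀ < b ∧ b < b₁) := by
  have hg : StrictMono fun x : Xᵒᵈ ↦ -f (OrderDual.ofDual x) := fun _ _ hxy ↦ neg_lt_neg (hf hxy)
  obtain ⟨b₀, hb₀, hlt, hcov⟩ := hg.exists_succ_mem (B := OrderDual.ofDual ⁻¹' B)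
    (b₁ := OrderDual.toDual b₁) h
  exact ⟨b₀, hb₀, hlt, fun b hb hbb ↦ hcov b hb hbb.symm⟩

/-- If immediate successors exist in every subset, closed intervals are well-founded. -/
theorem wellFoundedLT_Icc_of_exists_succ {X : Type*} [LinearOrder X]
    (h : ∀ B : Set X, ∀ b₁ ∈ B, (¬ ∀ b ∈ B, b ≤ b₁) →
      ∃ b₂ ∈ B, b₁ < b₂ ∧ ∀ b ∈ B, ¬ (b₁ < b ∧ b < b₂)) (a b : X) :
    WellFoundedLT (Set.Icc a b) := by
  refine ⟨WellFounded.wellFounded_iff_has_min.2 fun C ⟨c, hc⟩ ↦ ?_⟩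
  have ha (x : Set.Icc a b) : a ≤ x := x.2.1
  by_cases haC : ∃ x ∈ C, (x : X) = a
  · obtain ⟨x, hx, hxa⟩ := haC
    exact ⟨x, hx, fun y _ hyx ↦ (ha y).not_gt ((Subtype.coe_lt_coe.2 hyx).trans_eq hxa)⟩
  · have hlt : ∀ x ∈ C, a < x := fun x hx ↦ (ha x).lt_of_ne fun e ↦ haC ⟨x, hx, e.symm⟩
    obtain ⟨_, rfl | ⟨m, hm, rfl⟩, ham, hcov⟩ := h (insert a (Subtype.val '' C)) a
      (Set.mem_insert _ _) fun hle ↦ (hlt c hc).not_ge (hle c (.inr ⟨c, hc, rfl⟩))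
    · exact (lt_irrefl _ ham).elim
    · exact ⟨m, hm, fun y hy hym ↦ hcov y (.inr ⟨y, hy, rfl⟩) ⟨hlt y hy, hym⟩⟩

/-- If immediate predecessors exist in every subset, closed intervals are well-founded for
the reverse order. -/
theorem wellFoundedGT_Icc_of_exists_pred {X : Type*} [LinearOrder X]
    (h : ∀ B : Set X, ∀ b₁ ∈ B, (¬ ∀ b ∈ B, b₁ ≤ b) →
      ∃ b₀ ∈ B, b₀ < b₁ ∧ ∀ b ∈ B, ¬ (b₀ < b ∧ b < b₁)) (a b : X) :
    WellFoundedGT (Set.Icc a b) := by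
  have := wellFoundedLT_Icc_of_exists_succ (X := Xᵒᵈ) (fun B b₁ hb₁ hB ↦
    let ⟨b₀, hb₀, hlt, hcov⟩ := h (OrderDual.toDual ⁻¹' B) (OrderDual.ofDual b₁) hb₁ hB
    ⟨OrderDual.toDual b₀, hb₀, hlt, fun c hc hcc ↦ hcov (OrderDual.ofDual c) hc hcc.symm⟩)
    (OrderDual.toDual b) (OrderDual.toDual a)
  let g : Set.Icc a b → Set.Icc (OrderDual.toDual b) (OrderDual.toDual a) :=
    fun x ↦ ⟨OrderDual.toDual x, x.2.2, x.2.1⟩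
  exact ⟨Subrelation.wf (r := InvImage (· < ·) g) id (InvImage.wf g this.wf)⟩

/-- Every locally finite linear order is isomorphic to a subset of `ℤ`. -/
theorem LocallyFiniteOrder.exists_orderIso_subset_int (X : Type*) [LinearOrder X]
    [LocallyFiniteOrder X] : ∃ S : Set ℤ, Nonempty (X ≃o S) := by
  rcases isEmpty_or_nonempty X with _ | _
  · exact ⟨∅, ⟨OrderIso.ofIsEmpty _ _⟩⟩
  · let := LinearLocallyFiniteOrder.succOrder X
    let := LinearLocallyFiniteOrder.predOrder X
    exact ⟨_, ⟨orderIsoRangeToZOfLinearSuccPredArch⟩⟩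


/-- A linearly ordered set `X` is order-isomorphic to a subset of `ℤ` iff
in every subset `B` of `X`, every element which is not least in `B` has an immediate
predecessor in `B` and every element which is not greatest in `B` has an immediate
successor in `B`. -/
theorem orderIso_subset_int_iff {X : Type*} [LinearOrder X] :
    (∃ S : Set ℤ, Nonempty (X ≃o S)) ↔
      ∀ B : Set X, ∀ b₁ ∈ B,
        ((¬ ∀ b ∈ B, b₁ ≤ b) →
          ∃ b₀ ∈ B, b₀ < b₁ ∧ ∀ b ∈ B, ¬ (b₀ < b ∧ b < b₁)) ∧
        ((¬ ∀ b ∈ B, b ≤ b₁) →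
          ∃ b₂ ∈ B, b₁ < b₂ ∧ ∀ b ∈ B, ¬ (b₁ < b ∧ b < b₂)) := by
  constructor
  · rintro ⟨S, ⟨e⟩⟩ B b₁ -
    have he : StrictMono fun x ↦ (e x : ℤ) := e.strictMono
    exact ⟨he.exists_pred_mem, he.exists_succ_mem⟩
  · intro h
    have hfin (a b : X) : (Set.Icc a b).Finite := by
      have := wellFoundedLT_Icc_of_exists_succ (fun B b₁ hb₁ ↦ (h B b₁ hb₁).2) a b
      have := wellFoundedGT_Icc_of_exists_pred (fun B b₁ hb₁ ↦ (h B b₁ hb₁).1) a b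
      exact Set.finite_coe_iff.1 (Finite.of_wellFoundedLT_wellFoundedGT _)
    let := LocallyFiniteOrder.ofFiniteIcc hfin
    exact LocallyFiniteOrder.exists_orderIso_subset_int X
end

section
/- Every finite quasilattice is a lattice: if Y is a finite poset such that for all (finite) subsets A, B ⊆ Y with a ≤ b for every a ∈ A and every b ∈ B there exists y* ∈ Y with a ≤ y* ≤ b for all a ∈ A and b ∈ B, then every pair of elements of Y has a supremum and an infimum in Y (in fact every subset of Y has a supremum and an infimum, so Y is a complete lattice). -/
/-- Every finite quasilattice is a (complete) lattice: if `Y` is a finite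
poset such that for all finite `A, B ⊆ Y` with `a ≤ b` for all `a ∈ A`, `b ∈ B` there is
`y*` with `a ≤ y* ≤ b` for all `a ∈ A`, `b ∈ B`, then every subset of `Y` has a supremum
and an infimum in `Y`. -/
theorem finite_quasilattice_is_lattice {Y : Type*} [PartialOrder Y] [Finite Y]
    (hq : ∀ A B : Set Y, A.Finite → B.Finite →
      (∀ a ∈ A, ∀ b ∈ B, a ≤ b) →
        ∃ y : Y, (∀ a ∈ A, a ≤ y) ∧ ∀ b ∈ B, y ≤ b) :
    ∀ S : Set Y, (∃ y : Y, IsLUB S y) ∧ (∃ y : Y, IsGLB S y) := by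
  intro S
  constructor
  · obtain ⟨y, hS, hU⟩ := hq S (upperBounds S) S.toFinite (Set.toFinite _)
      fun a ha b hb => hb ha
    exact ⟨y, fun a ha => hS a ha, fun b hb => hU b hb⟩
  · obtain ⟨y, hL, hS⟩ := hq (lowerBounds S) S (Set.toFinite _) S.toFinite
      fun a ha b hb => ha hb
    exact ⟨y, fun b hb => hS b hb, fun a ha => hL a ha⟩
end

section
/- Let Y be a nonempty partially ordered set. Then Y is a quasilattice if and only if for every finite partially ordered set X and every subset A of X (with the induced order), every isotone map f : A → Y has an isotone extension g : X → Y. -/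
/-- In a quasilattice, a map on a finite poset that is isotone on `S` can be modified
off `S` so as to be isotone on `insert x S`. -/
theorem exists_monotoneOn_insert {X Y : Type*} [PartialOrder X] [Finite X] [PartialOrder Y]
    (hY : ∀ A B : Set Y, A.Finite → B.Finite → (∀ a ∈ A, ∀ b ∈ B, a ≤ b) →
      ∃ y : Y, (∀ a ∈ A, a ≤ y) ∧ ∀ b ∈ B, y ≤ b)
    {S : Set X} {g : X → Y} (hg : MonotoneOn g S) (x : X) :
    ∃ g' : X → Y, MonotoneOn g' (insert x S) ∧ Set.EqOn g' g S := by
  classical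
  by_cases hx : x ∈ S
  · exact ⟨g, by rwa [Set.insert_eq_of_mem hx], Set.eqOn_refl g S⟩
  obtain ⟨y, hlower, hupper⟩ := hY (g '' {a | a ∈ S ∧ a ≤ x}) (g '' {b | b ∈ S ∧ x ≤ b})
    (Set.toFinite _) (Set.toFinite _) (by
      rintro _ ⟨a, ⟨ha, hax⟩, rfl⟩ _ ⟨b, ⟨hb, hxb⟩, rfl⟩
      exact hg ha hb (hax.trans hxb))
  have heq : Set.EqOn (Function.update g x y) g S := fun a ha =>
    Function.update_of_ne (fun h : a = x => hx (h ▸ ha)) _ _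
  refine ⟨Function.update g x y, ?_, heq⟩
  rintro a (rfl | ha) b (rfl | hb) hab
  · exact le_rfl
  · rw [Function.update_self, heq hb]
    exact hupper _ ⟨b, ⟨hb, hab⟩, rfl⟩
  · rw [Function.update_self, heq ha]
    exact hlower _ ⟨a, ⟨ha, hab⟩, rfl⟩
  · rw [heq ha, heq hb]
    exact hg ha hb hab

/-- In a quasilattice, a map on a finite poset that is isotone on `S` agrees on `S` with
an isotone map. -/
theorem exists_monotone_eqOn {X Y : Type*} [PartialOrder X] [Finite X] [PartialOrder Y]
    (hY : ∀ A B : Set Y, A.Finite → B.Finite → (∀ a ∈ A, ∀ b ∈ B, a ≤ b) →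
      ∃ y : Y, (∀ a ∈ A, a ≤ y) ∧ ∀ b ∈ B, y ≤ b)
    {S : Set X} {g : X → Y} (hg : MonotoneOn g S) :
    ∃ g' : X → Y, Monotone g' ∧ Set.EqOn g' g S := by
  have key : ∀ T : Set X, T.Finite →
      ∃ g' : X → Y, MonotoneOn g' (T ∪ S) ∧ Set.EqOn g' g S := by
    intro T hT
    induction T, hT using Set.Finite.induction_on with
    | empty => exact ⟨g, by rwa [Set.empty_union], Set.eqOn_refl g S⟩
    | @insert x T _ _ ih =>
      obtain ⟨g₁, hmono, heq⟩ := ih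
      obtain ⟨g₂, hmono', heq'⟩ := exists_monotoneOn_insert hY hmono x
      exact ⟨g₂, by rwa [Set.insert_union],
        (heq'.mono Set.subset_union_right).trans heq⟩
  obtain ⟨g', hmono, heq⟩ := key Set.univ Set.finite_univ
  rw [Set.univ_union] at hmono
  exact ⟨g', monotoneOn_univ.1 hmono, heq⟩

/-- A nonempty poset `Y` is a quasilattice iff for every finite poset `X`
and every `A ⊆ X` (induced order), every isotone `f : A → Y` has an isotone extension
`g : X → Y`. -/
theorem quasilattice_iff_extension_finite_domain {Y : Type u} [PartialOrder Y] [Nonempty Y] :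
    (∀ A B : Set Y, A.Finite → B.Finite →
      (∀ a ∈ A, ∀ b ∈ B, a ≤ b) →
        ∃ y : Y, (∀ a ∈ A, a ≤ y) ∧ ∀ b ∈ B, y ≤ b) ↔
      (∀ (X : Type u) [PartialOrder X] [Finite X] (A : Set X) (f : A → Y),
        Monotone f → ∃ g : X → Y, Monotone g ∧ ∀ a : A, g (a : X) = f a) := by
  classical
  constructor
  · intro hY X _ _ A f hf
    let g₀ : X → Y := fun x => if h : x ∈ A then f ⟨x, h⟩ else Classical.arbitrary Y
    have hg₀ : ∀ a : A, g₀ a = f a := fun a => dif_pos a.2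
    obtain ⟨g, hg, heq⟩ := exists_monotone_eqOn hY (S := A) (g := g₀) (by
      intro a ha b hb hab
      rw [hg₀ ⟨a, ha⟩, hg₀ ⟨b, hb⟩]
      exact hf hab)
    exact ⟨g, hg, fun a => (heq a.2).trans (hg₀ a)⟩
  · intro hext A B hA hB hAB
    have := hA.to_subtype
    have := hB.to_subtype
    let X := A ⊕ₗ (PUnit.{u + 1} ⊕ₗ B)
    have : Finite X := inferInstanceAs (Finite (A ⊕ (PUnit.{u + 1} ⊕ B)))
    let lower : A → X := fun a => Sum.inlₗ a
    let mid : X := Sum.inrₗ (Sum.inlₗ PUnit.unit)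
    let upper : B → X := fun b => Sum.inrₗ (Sum.inrₗ b)
    let h : X → Y := fun x => Sum.elim (fun a : A => (a : Y))
      (fun z => Sum.elim (fun _ => Classical.arbitrary Y) (fun b : B => (b : Y)) (ofLex z))
      (ofLex x)
    obtain ⟨g, hg, heq⟩ := hext X {x | x ≠ mid} (fun x => h x) (by
      rintro ⟨a | (⟨⟩ | a), ha⟩ ⟨b | (⟨⟩ | b), hb⟩ hab
      · have hle : a ≤ b := Sum.Lex.inl_le_inl_iff.1 hab
        exact hle
      · exact absurd rfl hb
      · exact hAB _ a.2 _ b.2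
      · exact absurd rfl ha
      · exact absurd rfl ha
      · exact absurd rfl ha
      · exact absurd hab Sum.Lex.not_inr_le_inl
      · exact absurd rfl hb
      · have hle : a ≤ b := Sum.Lex.inr_le_inr_iff.1 (Sum.Lex.inr_le_inr_iff.1 hab)
        exact hle)
    refine ⟨g mid, fun a ha => ?_, fun b hb => ?_⟩
    · have hne : lower ⟨a, ha⟩ ≠ mid := fun h => Sum.inl_ne_inr h
      have hle : lower ⟨a, ha⟩ ≤ mid := Sum.Lex.inl_le_inr _ _
      exact (heq ⟨_, hne⟩).symm.trans_le (hg hle)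
    · have hne : upper ⟨b, hb⟩ ≠ mid := fun h => Sum.inr_ne_inl (Sum.inr_injective h)
      have hle : mid ≤ upper ⟨b, hb⟩ := Sum.Lex.inr_le_inr_iff.2 (Sum.Lex.inl_le_inr _ _)
      exact (hg hle).trans_eq (heq ⟨_, hne⟩)
end

section
/- Let Y be a finite nonempty partially ordered set. Suppose that for every finite partially ordered set X and every subset A of X (with the induced order), every isotone map f : A → Y has an isotone extension g : X → Y. Then for every partially ordered set X and every subset A of X, every isotone map f : A → Y has an isotone extension g : X → Y. -/
universe u

/-- If `Y` is a finite nonempty poset for which the isotone extension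
problem is solvable for all finite posets `X` and all `A ⊆ X`, then it is solvable for
all posets `X` and all `A ⊆ X`. -/
theorem extension_from_finite_posets_suffices {Y : Type u} [PartialOrder Y] [Finite Y]
    [Nonempty Y]
    (h : ∀ (X : Type u) [PartialOrder X] [Finite X] (A : Set X) (f : A → Y),
      Monotone f → ∃ g : X → Y, Monotone g ∧ ∀ a : A, g (a : X) = f a) :
    ∀ (X : Type u) [PartialOrder X] (A : Set X) (f : A → Y),
      Monotone f → ∃ g : X → Y, Monotone g ∧ ∀ a : A, g (a : X) = f a := by
  intro X _ A f hf
  have hfin (s : Finset X) : ∃ g : s → Y, Monotone g ∧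
      ∀ (x : s) (hx : (x : X) ∈ A), g x = f ⟨x, hx⟩ := by
    obtain ⟨g, hg, hgf⟩ := h s {x : s | (x : X) ∈ A} (fun a => f ⟨a.1, a.2⟩)
      (fun _ _ hab => hf hab)
    exact ⟨g, hg, fun x hx => hgf ⟨x, hx⟩⟩
  choose g hg hgf using hfin
  obtain ⟨χ, hχ⟩ := Finset.rado_selection_subtype (β := fun _ : X => Y) g
  classical
  refine ⟨χ, fun x y hxy => ?_, fun a => ?_⟩
  · obtain ⟨t, hst, ht⟩ := hχ {x, y}
    have hx := ht ⟨x, by simp⟩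
    have hy := ht ⟨y, by simp⟩
    rw [hx, hy]
    exact hg t hxy
  · obtain ⟨t, hst, ht⟩ := hχ {(a : X)}
    have ha := ht ⟨a, by simp⟩
    rw [ha]
    exact hgf t _ a.2
end

section
/- Let α be an infinite cardinal and let Y be an α-quasilattice. Then for every partially ordered set X of cardinality |X| < α and every subset A of X (with the induced order), every isotone map f : A → Y has an isotone extension g : X → Y. -/
universe u

/-- The set `G` of pairs is the graph of an isotone partial map. -/
def IsMonotoneGraph {X Y : Type*} [Preorder X] [Preorder Y] (G : Set (X × Y)) : Prop :=
  ∀ p ∈ G, ∀ q ∈ G, p.1 ≤ q.1 → p.2 ≤ q.2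

theorem IsMonotoneGraph.injOn_fst {X Y : Type*} [Preorder X] [PartialOrder Y]
    {G : Set (X × Y)} (hG : IsMonotoneGraph G) : Set.InjOn Prod.fst G :=
  fun p hp q hq h => Prod.ext h ((hG p hp q hq h.le).antisymm (hG q hq p hp h.ge))

theorem IsMonotoneGraph.mk_image_snd_le {X Y : Type u} [Preorder X] [PartialOrder Y]
    {G : Set (X × Y)} (hG : IsMonotoneGraph G) {S : Set (X × Y)} (hS : S ⊆ G) :
    Cardinal.mk (Prod.snd '' S) ≤ Cardinal.mk X :=
  Cardinal.mk_image_le.trans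
    (Cardinal.mk_le_of_injective (hG.injOn_fst.mono hS).injective)

theorem IsMonotoneGraph.insert {X Y : Type*} [Preorder X] [Preorder Y]
    {G : Set (X × Y)} (hG : IsMonotoneGraph G) {x : X} {y : Y}
    (hl : ∀ p ∈ G, p.1 ≤ x → p.2 ≤ y) (hu : ∀ p ∈ G, x ≤ p.1 → y ≤ p.2) :
    IsMonotoneGraph (insert (x, y) G) := by
  rintro p (rfl | hp) q (rfl | hq) h
  · exact le_rfl
  · exact hu q hq h
  · exact hl p hp h
  · exact hG p hp q hq h

theorem IsMonotoneGraph.exists_maximal {X Y : Type*} [Preorder X] [Preorder Y]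
    {G : Set (X × Y)} (hG : IsMonotoneGraph G) :
    ∃ M, G ⊆ M ∧ Maximal IsMonotoneGraph M := by
  refine zorn_subset_nonempty {H | IsMonotoneGraph H} (fun c hc hchain _ => ?_) G hG
  refine ⟨⋃₀ c, ?_, fun s hs => Set.subset_sUnion_of_mem hs⟩
  rintro p ⟨s, hs, hp⟩ q ⟨t, ht, hq⟩ h
  rcases hchain.total hs ht with hst | hts
  · exact hc ht p (hst hp) q hq h
  · exact hc hs p hp q (hts hq) h

/-- If `α` is an infinite cardinal and `Y` is an `α`-quasilattice, then for
every poset `X` with `|X| < α` and every `A ⊆ X` (induced order), every isotone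
`f : A → Y` has an isotone extension `g : X → Y`. -/
theorem alpha_quasilattice_extension {Y : Type u} [PartialOrder Y]
    (α : Cardinal.{u}) (hα : Cardinal.aleph0 ≤ α)
    (hq : ∀ A B : Set Y, Cardinal.mk A < α → Cardinal.mk B < α →
      (∀ a ∈ A, ∀ b ∈ B, a ≤ b) →
        ∃ y : Y, (∀ a ∈ A, a ≤ y) ∧ ∀ b ∈ B, y ≤ b) :
    ∀ (X : Type u) [PartialOrder X], Cardinal.mk X < α →
      ∀ (A : Set X) (f : A → Y), Monotone f →
        ∃ g : X → Y, Monotone g ∧ ∀ a : A, g (a : X) = f a := by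
  intro X _ hX A f hf
  have hG : IsMonotoneGraph (Set.range fun a : A => ((a : X), f a)) := by
    rintro _ ⟨a, rfl⟩ _ ⟨b, rfl⟩ h
    exact hf h
  obtain ⟨M, hGM, hM⟩ := hG.exists_maximal
  have total (x : X) : ∃ y, (x, y) ∈ M := by
    obtain ⟨y, hl, hu⟩ := hq (Prod.snd '' {p ∈ M | p.1 ≤ x}) (Prod.snd '' {p ∈ M | x ≤ p.1})
      ((hM.prop.mk_image_snd_le (Set.sep_subset _ _)).trans_lt hX)
      ((hM.prop.mk_image_snd_le (Set.sep_subset _ _)).trans_lt hX)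
      (by
        rintro _ ⟨p, ⟨hp, hpx⟩, rfl⟩ _ ⟨q, ⟨hq, hxq⟩, rfl⟩
        exact hM.prop p hp q hq (hpx.trans hxq))
    have hins : IsMonotoneGraph (insert (x, y) M) :=
      hM.prop.insert (fun p hp h => hl _ ⟨p, ⟨hp, h⟩, rfl⟩) (fun p hp h => hu _ ⟨p, ⟨hp, h⟩, rfl⟩)
    exact ⟨y, hM.le_of_ge hins (Set.subset_insert _ _) (Set.mem_insert _ _)⟩
  choose g hg using total
  refine ⟨g, fun x x' h => hM.prop _ (hg x) _ (hg x') h, fun a => ?_⟩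
  exact congrArg Prod.snd (hM.prop.injOn_fst (hg a) (hGM ⟨a, rfl⟩) rfl)
end

section
/- Let α be an infinite cardinal and let Y be a nonempty partially ordered set. Suppose that for every partially ordered set X and every subset A of X (with the induced order) of cardinality |A| < α, every isotone map f : A → Y has an isotone extension g : X → Y. Then Y is an α-quasilattice. -/
universe u

/-- If `α` is an infinite cardinal and the nonempty poset `Y` is such that
for every poset `X` and every `A ⊆ X` with `|A| < α` every isotone `f : A → Y` has an
isotone extension to `X`, then `Y` is an `α`-quasilattice. -/
theorem alpha_quasilattice_of_extension {Y : Type u} [PartialOrder Y] [Nonempty Y]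
    (α : Cardinal.{u}) (hα : Cardinal.aleph0 ≤ α)
    (h : ∀ (X : Type u) [PartialOrder X] (A : Set X), Cardinal.mk A < α →
      ∀ f : A → Y, Monotone f →
        ∃ g : X → Y, Monotone g ∧ ∀ a : A, g (a : X) = f a) :
    ∀ A B : Set Y, Cardinal.mk A < α → Cardinal.mk B < α →
      (∀ a ∈ A, ∀ b ∈ B, a ≤ b) →
        ∃ y : Y, (∀ a ∈ A, a ≤ y) ∧ ∀ b ∈ B, y ≤ b := by
  intro A B hA hB hAB
  let e : A ⊕ B → A ⊕ₗ WithBot B :=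
    Sum.elim (fun a => toLex (Sum.inl a)) fun b => toLex (Sum.inr (b : WithBot B))
  let v : A ⊕ₗ WithBot B → Y := fun x =>
    Sum.elim (fun a : A => (a : Y))
      (fun b : WithBot B => WithBot.recBotCoe (Classical.arbitrary Y) (fun b : B => (b : Y)) b)
      (ofLex x)
  have card_range : Cardinal.mk (Set.range e) < α := by
    refine Cardinal.mk_range_le.trans_lt ?_
    rw [Cardinal.mk_sum, Cardinal.lift_id, Cardinal.lift_id]
    exact Cardinal.add_lt_of_lt hα hA hB
  have mono_v : Monotone fun x : Set.range e => v x := by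
    rintro ⟨_, a | b, rfl⟩ ⟨_, a' | b', rfl⟩ hle
    · exact (Sum.Lex.inl_le_inl_iff.mp hle : a ≤ a')
    · exact hAB a a.2 b' b'.2
    · exact absurd hle Sum.Lex.not_inr_le_inl
    · exact (WithBot.coe_le_coe.mp (Sum.Lex.inr_le_inr_iff.mp hle) : b ≤ b')
  obtain ⟨g, mono_g, hg⟩ := h _ (Set.range e) card_range _ mono_v
  refine ⟨g (toLex (Sum.inr ⊥)), fun a ha => ?_, fun b hb => ?_⟩
  · exact (hg ⟨_, Sum.inl ⟨a, ha⟩, rfl⟩).symm.trans_le (mono_g (Sum.Lex.inl_le_inr _ _))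
  · exact (mono_g (Sum.Lex.inr_le_inr_iff.mpr bot_le)).trans_eq (hg ⟨_, Sum.inr ⟨b, hb⟩, rfl⟩)
end

section
/- Let Y be a nonempty partially ordered set. Then Y is a complete local lattice if and only if the following holds: for every partially ordered set X and every subset A of X (with the induced order) possessing a least element a_* and a greatest element a^*, every isotone map f : A → Y has an isotone extension g : X → Y preserving the extremal values, i.e., satisfying f(a_*) ≤ g(x) ≤ f(a^*) for all x ∈ X. -/
universe u

/-- If the canonical embedding `a ↦ Iic a` of a poset into its power set has a monotone left
inverse, then every subset has a supremum and an infimum. -/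
theorem exists_isLUB_and_exists_isGLB_of_monotone_retraction {I : Type*} [PartialOrder I]
    (r : Set I → I) (hr : Monotone r) (hr_Iic : ∀ a, r (Set.Iic a) = a) (S : Set I) :
    (∃ m, IsLUB S m) ∧ (∃ m, IsGLB S m) := by
  refine ⟨⟨r (lowerClosure S), fun s hs => ?_, fun b hb => ?_⟩,
    ⟨r (lowerBounds S), fun s hs => ?_, fun b hb => ?_⟩⟩
  · rw [← hr_Iic s]
    exact hr fun t ht => ⟨s, hs, ht⟩
  · rw [← hr_Iic b]
    exact hr fun t ⟨s, hs, hts⟩ => hts.trans (hb hs)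
  · rw [← hr_Iic s]
    exact hr fun t ht => ht hs
  · rw [← hr_Iic b]
    exact hr fun t ht s hs => le_trans ht (hb hs)

/-- A monotone map from a subset of a poset to a poset in which all suprema exist extends to a
monotone map on the whole poset. -/
theorem exists_monotone_extension_of_exists_isLUB {X I : Type*} [PartialOrder X] [PartialOrder I]
    (hI : ∀ S : Set I, ∃ m, IsLUB S m) {A : Set X} {f : A → I} (hf : Monotone f) :
    ∃ g : X → I, Monotone g ∧ ∀ a : A, g a = f a := by
  choose sup hsup using hI
  refine ⟨fun x => sup (f '' {a | (a : X) ≤ x}), fun x y hxy => ?_, fun a => ?_⟩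
  · exact (hsup _).mono (hsup _) (Set.image_mono fun a ha => le_trans ha hxy)
  · refine (hsup _).unique ⟨?_, fun b hb => hb ⟨a, le_refl (a : X), rfl⟩⟩
    rintro _ ⟨c, hc, rfl⟩
    exact hf hc

/-- A nonempty poset `Y` is a complete local lattice (every interval
`[y₁, y₂]` with the induced order is a complete lattice) iff for every poset `X` and
every `A ⊆ X` having a least element `a₀` and a greatest element `a₁`, every isotone
`f : A → Y` has an isotone extension preserving the extremal values. -/
theorem complete_local_lattice_iff_extremal_extension {Y : Type u} [PartialOrder Y]
    [Nonempty Y] :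
    (∀ y₁ y₂ : Y, y₁ ≤ y₂ →
        ∀ S : Set (Set.Icc y₁ y₂),
          (∃ m : Set.Icc y₁ y₂, IsLUB S m) ∧ (∃ m : Set.Icc y₁ y₂, IsGLB S m)) ↔
      (∀ (X : Type u) [PartialOrder X] (A : Set X) (a₀ a₁ : X)
        (h₀ : a₀ ∈ A) (h₁ : a₁ ∈ A),
        (∀ a ∈ A, a₀ ≤ a) → (∀ a ∈ A, a ≤ a₁) →
          ∀ f : A → Y, Monotone f →
            ∃ g : X → Y, Monotone g ∧ (∀ a : A, g (a : X) = f a) ∧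
              ∀ x : X, f ⟨a₀, h₀⟩ ≤ g x ∧ g x ≤ f ⟨a₁, h₁⟩) := by
  constructor
  · intro hY X _ A a₀ a₁ h₀ h₁ hmin hmax f hf
    have hmem : ∀ a : A, f a ∈ Set.Icc (f ⟨a₀, h₀⟩) (f ⟨a₁, h₁⟩) := fun a =>
      ⟨hf (hmin a a.2), hf (hmax a a.2)⟩
    have hle : f ⟨a₀, h₀⟩ ≤ f ⟨a₁, h₁⟩ := (hmem ⟨a₁, h₁⟩).1
    obtain ⟨g, hg, hgf⟩ := exists_monotone_extension_of_exists_isLUB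
      (fun S => (hY _ _ hle S).1) (f := fun a => ⟨f a, hmem a⟩) (fun _ _ hab => hf hab)
    exact ⟨fun x => g x, fun _ _ hxy => hg hxy, fun a => congrArg Subtype.val (hgf a),
      fun x => (g x).2⟩
  · intro hext y₁ y₂ hle S
    let bot : Set.Icc y₁ y₂ := ⟨y₁, le_rfl, hle⟩
    let top : Set.Icc y₁ y₂ := ⟨y₂, hle, le_rfl⟩
    let A : Set (Set (Set.Icc y₁ y₂)) := Set.range Set.Iic
    choose p hp using fun a : A => a.2
    have hp_Iic : ∀ b, p ⟨Set.Iic b, b, rfl⟩ = b := fun b => Set.Iic_injective (hp _)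
    have hp_mono : Monotone p := fun a b hab => by
      rw [← Set.Iic_subset_Iic, hp, hp]
      exact hab
    obtain ⟨g, hg, hgf, hgb⟩ := hext (Set (Set.Icc y₁ y₂)) A (Set.Iic bot) (Set.Iic top)
      ⟨bot, rfl⟩ ⟨top, rfl⟩
      (by rintro _ ⟨b, rfl⟩; exact Set.Iic_subset_Iic.2 b.2.1)
      (by rintro _ ⟨b, rfl⟩; exact Set.Iic_subset_Iic.2 b.2.2)
      (fun a => p a) (fun _ _ hab => hp_mono hab)
    rw [hp_Iic, hp_Iic] at hgb
    exact exists_isLUB_and_exists_isGLB_of_monotone_retraction (fun D => ⟨g D, hgb D⟩)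
      (fun _ _ hDE => hg hDE)
      (fun b => Subtype.ext ((hgf ⟨Set.Iic b, b, rfl⟩).trans (congrArg Subtype.val (hp_Iic b)))) S
end
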